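/- The best-of-three erasure map from labeled binary trees of size n to labeled binary trees of size n−1 is exactly (4n−2)-to-1 for every n ≥ 2: every labeled binary tree of size n−1 has exactly 4n−2 preimages. -/

import Mathlib

/-- A plane binary tree whose non-root leaves carry natural-number labels.
The root leaf (always labeled 0) is left implicit: an `LTree` is the part of
the tree above the unique edge incident to the root. -/
inductive LTree where
  | leaf : ℕ → LTree
  | node : LTree → LTree → LTree
deriving DecidableEq

namespace LTree

/-- The size: number of branching (degree-3) nodes. -/
def size : LTree → ℕ
  | leaf _ => 0
  | node l r => size l + size r + 1

/-- The list of labels of the (non-root) leaves, left to right. -/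
def labs : LTree → List ℕ
  | leaf a => [a]
  | node l r => labs l ++ labs r

/-- `t` is a labeled binary tree of size `n`: it has `n` branching nodes and its
`n+1` non-root leaves are bijectively labeled by `{1,…,n+1}` (the root leaf gets 0). -/
def IsLab (n : ℕ) (t : LTree) : Prop :=
  size t = n ∧ List.Perm (labs t) ((List.range (n + 1)).map (· + 1))

/-- Number of elements of `L` strictly smaller than `x`. -/
def rank (L : List ℕ) (x : ℕ) : ℕ := L.countP (fun y => decide (y < x))

/-- Best-of-three comparison at a branching node with children `l`, `r`:
`true` iff at least two of the three minimally-labeled leaves of the fringe set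
lie in the left child `l`. -/
def goLeft (l r : LTree) : Bool :=
  decide (2 ≤ (labs l).countP (fun x => decide (rank (labs l ++ labs r) x < 3)))

/-- The branching node selected by the best-of-three procedure (returned as the
fringe subtree rooted at it). -/
def botSel : LTree → LTree
  | leaf a => leaf a
  | node (leaf a) (leaf b) => node (leaf a) (leaf b)
  | node l r => if goLeft l r then botSel l else botSel r

/-- The number of moves performed by the best-of-three selection. -/
def botDepth : LTree → ℕ
  | leaf _ => 0
  | node (leaf _) (leaf _) => 0
  | node l r => (if goLeft l r then botDepth l else botDepth r) + 1

/-- The position (sequence of left/right moves, `false` = left) of the selected node. -/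
def botPos : LTree → List Bool
  | leaf _ => []
  | node (leaf _) (leaf _) => []
  | node l r => if goLeft l r then false :: botPos l else true :: botPos r

/-- Cut at the selected node: the two sibling leaves above it are removed, the
node becomes a leaf carrying the smaller label; returns the cut tree together
with the erased (BoT) label, i.e. the larger of the two. -/
def botCut : LTree → LTree × ℕ
  | leaf a => (leaf a, 0)
  | node (leaf a) (leaf b) => (leaf (min a b), max a b)
  | node l r =>
    if goLeft l r then (node (botCut l).1 r, (botCut l).2)
    else (node l (botCut r).1, (botCut r).2)

/-- Relabel increasingly after erasing label `j`. -/
def relabel (j : ℕ) : LTree → LTree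
  | leaf a => leaf (if a < j then a else a - 1)
  | node l r => node (relabel j l) (relabel j r)

/-- The label of the Best-of-Three leaf. -/
def botLabel (t : LTree) : ℕ := (botCut t).2

/-- Best-of-three erasure, including the increasing relabeling. -/
def botErase (t : LTree) : LTree := relabel (botCut t).2 (botCut t).1

/-- Positions (in the original coordinates of `t`) of the branching nodes cut by
`k` successive best-of-three erasures, in order of erasure. -/
def eraseList : ℕ → LTree → List (List Bool)
  | 0, _ => []
  | k + 1, t => botPos t :: eraseList k (botErase t)

/-- The fringe subtree at a position (`false` = left child, `true` = right child). -/
def subAt : LTree → List Bool → Option LTree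
  | t, [] => some t
  | leaf _, _ :: _ => none
  | node l _, false :: p => subAt l p
  | node _ r, true :: p => subAt r p

/-- Shift labels `≥ j` up by one, freeing the label `j`. -/
def relabelUp (j : ℕ) : LTree → LTree
  | leaf a => leaf (if a < j then a else a + 1)
  | node l r => node (relabelUp j l) (relabelUp j r)

/-- Graft a new leaf labeled `j` to the left (`side = false`) or right
(`side = true`) of the leaf labeled `w`. -/
def graft (w j : ℕ) (side : Bool) : LTree → LTree
  | leaf a =>
    if a = w then (if side then node (leaf a) (leaf j) else node (leaf j) (leaf a))
    else leaf a
  | node l r => node (graft w j side l) (graft w j side r)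

/-- The binary tree obtained from the `ℓ`-span (the unary–binary subtree spanned by
the root and the leaves labeled `1,…,ℓ`) by contracting its degree-2 vertices. -/
def trim (ℓ : ℕ) : LTree → LTree
  | leaf a => leaf a
  | node l r =>
    if (labs l).all (fun x => decide (ℓ < x)) then trim ℓ r
    else if (labs r).all (fun x => decide (ℓ < x)) then trim ℓ l
    else node (trim ℓ l) (trim ℓ r)

/-- Map a position in `trim ℓ t` back to the corresponding position in `t`. -/
def trimPos (ℓ : ℕ) : LTree → List Bool → List Bool
  | leaf _, p => p
  | node l r, p =>
    if (labs l).all (fun x => decide (ℓ < x)) then true :: trimPos ℓ r p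
    else if (labs r).all (fun x => decide (ℓ < x)) then false :: trimPos ℓ l p
    else
      match p with
      | [] => []
      | true :: q => true :: trimPos ℓ r q
      | false :: q => false :: trimPos ℓ l q

end LTree

namespace LTree

lemma rank_mono (L : List ℕ) : Monotone (rank L) := fun x y hxy =>
  List.countP_mono_left fun z _ hz => by
    simp only [decide_eq_true_eq] at hz ⊢
    omega

lemma rank_perm {L M : List ℕ} (h : L.Perm M) : rank L = rank M :=
  funext fun _ => h.countP_eq _

lemma rank_lt_rank {L : List ℕ} {x y : ℕ} (hx : x ∈ L) (hxy : x < y) :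
    rank L x < rank L y := by
  obtain ⟨A, B, rfl⟩ := List.append_of_mem hx
  have hA := rank_mono A hxy.le
  have hB := rank_mono B hxy.le
  simp only [rank, List.countP_append, List.countP_cons] at *
  simp [hxy]
  omega

lemma rank_lt_length {L : List ℕ} {x : ℕ} (hx : x ∈ L) : rank L x < L.length := by
  obtain ⟨A, B, rfl⟩ := List.append_of_mem hx
  have hA := List.countP_le_length (p := fun y => decide (y < x)) (l := A)
  have hB := List.countP_le_length (p := fun y => decide (y < x)) (l := B)
  simp [rank, List.countP_append]
  omega

/-- In a list without repetitions, exactly `m` entries have rank less than `m`. -/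
lemma countP_rank_lt {L : List ℕ} (hL : L.Nodup) {m : ℕ} (hm : m ≤ L.length) :
    L.countP (fun x => decide (rank L x < m)) = m := by
  have hinj : Set.InjOn (rank L) L.toFinset := by
    intro x hx y hy hxy
    simp only [List.coe_toFinset, Set.mem_ofPred_eq] at hx hy
    rcases lt_trichotomy x y with h | h | h
    · exact absurd hxy (rank_lt_rank hx h).ne
    · exact h
    · exact absurd hxy (rank_lt_rank hy h).ne'
  have himage : L.toFinset.image (rank L) = Finset.range L.length := by
    apply Finset.eq_of_subset_of_card_le
    · intro i hi
      obtain ⟨x, hx, rfl⟩ := Finset.mem_image.mp hi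
      exact Finset.mem_range.mpr (rank_lt_length (List.mem_toFinset.mp hx))
    · rw [Finset.card_image_of_injOn hinj, List.toFinset_card_of_nodup hL, Finset.card_range]
  have hfilter : (L.toFinset.filter (fun x => rank L x < m)).image (rank L) = Finset.range m := by
    ext i
    constructor
    · intro hi
      obtain ⟨x, hx, rfl⟩ := Finset.mem_image.mp hi
      exact Finset.mem_range.mpr (Finset.mem_filter.mp hx).2
    · intro hi
      have him := Finset.mem_range.mp hi
      have : i ∈ L.toFinset.image (rank L) := by
        rw [himage]
        exact Finset.mem_range.mpr (by omega)
      obtain ⟨x, hx, rfl⟩ := Finset.mem_image.mp this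
      exact Finset.mem_image_of_mem _ (Finset.mem_filter.mpr ⟨hx, him⟩)
  rw [List.countP_eq_length_filter, ← List.toFinset_card_of_nodup (hL.filter _),
    List.toFinset_filter]
  simp only [decide_eq_true_eq]
  rw [← Finset.card_image_of_injOn (hinj.mono (Finset.coe_subset.mpr (Finset.filter_subset _ _))),
    hfilter, Finset.card_range]

lemma length_labs (t : LTree) : (labs t).length = size t + 1 := by
  induction t with
  | leaf a => rfl
  | node l r ihl ihr => simp [labs, size, ihl, ihr]; omega

/-- `goLeft` only depends on the labels of the two children. -/
lemma goLeft_iff_of_perm {l r : LTree} {L R : List ℕ} (hl : (labs l).Perm L)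
    (hr : (labs r).Perm R) :
    goLeft l r = true ↔ 2 ≤ L.countP (fun x => decide (rank (L ++ R) x < 3)) := by
  rw [goLeft, decide_eq_true_eq, rank_perm (hl.append hr), hl.countP_eq]

lemma botCut_node {l r : LTree} (h : size l + size r ≠ 0) :
    botCut (node l r) =
      if goLeft l r then (node (botCut l).1 r, (botCut l).2)
      else (node l (botCut r).1, (botCut r).2) := by
  cases l <;> cases r <;> simp_all [botCut, size]

lemma size_ne_zero_of_botCut {t : LTree} (h : 0 < (botCut t).2) : size t ≠ 0 := by
  cases t <;> simp_all [botCut, size]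

/-- The cut removes exactly the erased label. -/
lemma labs_perm_botCut {t : LTree} (h : 0 < (botCut t).2) :
    (labs t).Perm ((botCut t).2 :: labs (botCut t).1) := by
  induction t with
  | leaf a => simp [botCut] at h
  | node l r ihl ihr =>
    by_cases hs : size l + size r = 0
    · cases l <;> cases r <;> simp [size] at hs
      rename_i a b
      simp only [botCut, labs, List.cons_append, List.nil_append]
      rcases le_total a b with hab | hab
      · simpa [hab] using List.Perm.swap b a []
      · simp [hab]
    · rw [botCut_node hs] at h ⊢
      split_ifs at h ⊢
      · exact (ihl h).append_right _
      · exact ((ihr h).append_left _).trans List.perm_middle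

/-- The selection never gets stuck at a leaf. -/
lemma botCut_snd_pos {t : LTree} (ht : size t ≠ 0) (hnd : (labs t).Nodup)
    (hpos : ∀ x ∈ labs t, 0 < x) : 0 < (botCut t).2 := by
  induction t with
  | leaf a => simp [size] at ht
  | node l r ihl ihr =>
    have hndl := (List.nodup_append.mp hnd).1
    have hndr := (List.nodup_append.mp hnd).2.1
    by_cases hs : size l + size r = 0
    · cases l <;> cases r <;> simp [size] at hs
      rename_i a b
      simpa [botCut] using Or.inl (hpos a (by simp [labs]))
    · rw [botCut_node hs]
      have hcount : (labs l ++ labs r).countP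
          (fun x => decide (rank (labs l ++ labs r) x < 3)) = 3 :=
        countP_rank_lt hnd (by rw [length_labs, size]; omega)
      rw [List.countP_append] at hcount
      have hl := List.countP_le_length
        (p := fun x => decide (rank (labs l ++ labs r) x < 3)) (l := labs l)
      have hr := List.countP_le_length
        (p := fun x => decide (rank (labs l ++ labs r) x < 3)) (l := labs r)
      rw [length_labs] at hl hr
      split_ifs with hg <;> simp only [goLeft, decide_eq_true_eq] at hg
      · exact ihl (by omega) hndl fun x hx => hpos x (by simp [labs, hx])
      · exact ihr (by omega) hndr fun x hx => hpos x (by simp [labs, hx])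

/-- Inserting `j` on either side of a branching node: the numbers of admissible insertions
below the two children add up to the number for the whole fringe set. -/
lemma insertion_count {L R : List ℕ} {j : ℕ} (hnd : (j :: (L ++ R)).Nodup) (hL : L ≠ [])
    (hR : R ≠ []) :
    (if 2 ≤ (j :: L).countP (fun x => decide (rank (j :: L ++ R) x < 3))
      then 2 * min (rank L j) 2 else 0) +
    (if 2 ≤ L.countP (fun x => decide (rank (L ++ j :: R) x < 3))
      then 0 else 2 * min (rank R j) 2) = 2 * min (rank (L ++ R) j) 2 := by
  have hlL := List.length_pos_of_ne_nil hL
  have hlR := List.length_pos_of_ne_nil hR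
  rw [rank_perm (List.perm_middle (a := j) (l₁ := L) (l₂ := R)), List.cons_append]
  set U := j :: (L ++ R) with hU
  have htotal : (j :: (L ++ R)).countP (fun x => decide (rank U x < 3)) = 3 :=
    countP_rank_lt hnd (by simp [hU]; omega)
  have hrank : rank U j = rank L j + rank R j := by simp [hU, rank, List.countP_append]
  rw [show rank (L ++ R) j = rank L j + rank R j by simp [rank, List.countP_append]]
  rw [List.countP_cons, List.countP_append, hrank] at htotal
  rw [List.countP_cons, hrank]
  by_cases hk : rank L j + rank R j < 3
  · have hle : ∀ M : List ℕ, rank M j ≤ M.countP (fun x => decide (rank U x < 3)) := fun M =>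
      List.countP_mono_left fun x _ hx => by
        simp only [decide_eq_true_eq] at hx ⊢
        exact (rank_mono U hx.le).trans_lt (hrank ▸ hk)
    have h1 := hle L
    have h2 := hle R
    simp only [hk, decide_true, if_true] at htotal ⊢
    split_ifs <;> omega
  · have hle : ∀ M : List ℕ, M.countP (fun x => decide (rank U x < 3)) ≤ rank M j := fun M =>
      List.countP_mono_left fun x _ hx => by
        simp only [decide_eq_true_eq] at hx ⊢
        by_contra hjx
        exact hk (hrank ▸ (rank_mono U (not_lt.mp hjx)).trans_lt hx)
    have h1 := hle L
    have h2 := hle R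
    simp only [hk, decide_false, Bool.false_eq_true, if_false] at htotal ⊢
    split_ifs <;> omega

lemma botCut_eq_leaf_iff {t : LTree} {a j : ℕ} (hj : 0 < j) :
    botCut t = (leaf a, j) ↔ a ≤ j ∧ (t = node (leaf a) (leaf j) ∨ t = node (leaf j) (leaf a)) := by
  constructor
  · intro h
    cases t with
    | leaf b => simp [botCut] at h; omega
    | node l r =>
      by_cases hs : size l + size r = 0
      · cases l <;> cases r <;> simp [size] at hs
        simp only [botCut, Prod.mk.injEq, leaf.injEq] at h
        simp only [node.injEq, leaf.injEq]
        omega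
      · rw [botCut_node hs] at h
        split_ifs at h <;> simp at h
  · rintro ⟨haj, rfl | rfl⟩ <;> simp [botCut, haj]

lemma botCut_eq_node_iff {t l r : LTree} {j : ℕ} (hj : 0 < j) :
    botCut t = (node l r, j) ↔
      (∃ s, botCut s = (l, j) ∧ goLeft s r = true ∧ t = node s r) ∨
      (∃ s, botCut s = (r, j) ∧ ¬ goLeft l s = true ∧ t = node l s) := by
  constructor
  · intro h
    cases t with
    | leaf b => simp [botCut] at h
    | node x y =>
      by_cases hs : size x + size y = 0
      · cases x <;> cases y <;> simp [size] at hs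
        simp [botCut] at h
      · rw [botCut_node hs] at h
        split_ifs at h with hg <;> simp only [Prod.mk.injEq, node.injEq] at h
        · obtain ⟨⟨h1, rfl⟩, h2⟩ := h
          exact Or.inl ⟨x, Prod.ext h1 h2, hg, rfl⟩
        · obtain ⟨⟨rfl, h1⟩, h2⟩ := h
          exact Or.inr ⟨y, Prod.ext h1 h2, hg, rfl⟩
  · rintro (⟨s, hs, hg, rfl⟩ | ⟨s, hs, hg, rfl⟩)
    all_goals
      have := size_ne_zero_of_botCut (t := s) (by rw [hs]; exact hj)
      rw [botCut_node (by omega)]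
      simp [hg, hs]

/-- The number of trees whose best-of-three cut yields `s` and erases the label `j`. -/
lemma encard_botCut_eq {s : LTree} {j : ℕ} (hj : 0 < j) (hnd : (j :: labs s).Nodup) :
    {t | botCut t = (s, j)}.encard = ((2 * min (rank (labs s) j) 2 : ℕ) : ℕ∞) := by
  induction s with
  | leaf a =>
    have haj : a ≠ j := by rintro rfl; simp [labs] at hnd
    simp only [botCut_eq_leaf_iff hj]
    by_cases h : a < j
    · have : {t | a ≤ j ∧ (t = node (leaf a) (leaf j) ∨ t = node (leaf j) (leaf a))} =
          {node (leaf a) (leaf j), node (leaf j) (leaf a)} := by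
        ext t; simp [h.le]
      rw [this, Set.encard_pair (by simp [haj])]
      simp [rank, labs, h]
    · have : ¬ a ≤ j := by omega
      simp [rank, labs, h, this]
  | node l r ihl ihr =>
    have hnd' : (j :: (labs l ++ labs r)).Nodup := hnd
    have hndl : (j :: labs l).Nodup :=
      hnd'.sublist ((List.sublist_append_left _ _).cons_cons j)
    have hndr : (j :: labs r).Nodup :=
      hnd'.sublist ((List.sublist_append_right _ _).cons_cons j)
    have hperm : ∀ {s u : LTree}, botCut s = (u, j) → (labs s).Perm (j :: labs u) := by
      intro s u hs
      simpa [hs] using labs_perm_botCut (t := s) (by rw [hs]; exact hj)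
    have hne : ∀ u : LTree, labs u ≠ [] := fun u =>
      List.ne_nil_of_length_pos (by rw [length_labs]; omega)
    have hleft : {t | ∃ s, botCut s = (l, j) ∧ goLeft s r = true ∧ t = node s r}.encard =
        ((if 2 ≤ (j :: labs l).countP (fun x => decide (rank (j :: labs l ++ labs r) x < 3))
          then 2 * min (rank (labs l) j) 2 else 0 : ℕ) : ℕ∞) := by
      split_ifs with hc
      · rw [← ihl hndl, ← Function.Injective.encard_image (f := fun s => node s r)
          (fun a b h => by simpa using h) {t | botCut t = (l, j)}]
        refine congrArg Set.encard (Set.ext fun t => ?_)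
        constructor
        · rintro ⟨s, hs, -, rfl⟩
          exact ⟨s, hs, rfl⟩
        · rintro ⟨s, hs, rfl⟩
          exact ⟨s, hs, (goLeft_iff_of_perm (hperm hs) (.refl _)).mpr hc, rfl⟩
      · rw [Nat.cast_zero, Set.encard_eq_zero, Set.eq_empty_iff_forall_notMem]
        rintro t ⟨s, hs, hg, rfl⟩
        exact hc ((goLeft_iff_of_perm (hperm hs) (.refl _)).mp hg)
    have hright : {t | ∃ s, botCut s = (r, j) ∧ ¬ goLeft l s = true ∧ t = node l s}.encard =
        ((if 2 ≤ (labs l).countP (fun x => decide (rank (labs l ++ j :: labs r) x < 3))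
          then 0 else 2 * min (rank (labs r) j) 2 : ℕ) : ℕ∞) := by
      split_ifs with hc
      · rw [Nat.cast_zero, Set.encard_eq_zero, Set.eq_empty_iff_forall_notMem]
        rintro t ⟨s, hs, hg, rfl⟩
        exact hg ((goLeft_iff_of_perm (.refl _) (hperm hs)).mpr hc)
      · rw [← ihr hndr, ← Function.Injective.encard_image (f := fun s => node l s)
          (fun a b h => by simpa using h) {t | botCut t = (r, j)}]
        refine congrArg Set.encard (Set.ext fun t => ?_)
        constructor
        · rintro ⟨s, hs, -, rfl⟩
          exact ⟨s, hs, rfl⟩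
        · rintro ⟨s, hs, rfl⟩
          exact ⟨s, hs, fun hg => hc ((goLeft_iff_of_perm (.refl _) (hperm hs)).mp hg), rfl⟩
    simp only [botCut_eq_node_iff hj, Set.ofPred_or]
    rw [Set.encard_union_eq, hleft, hright, ← Nat.cast_add,
      insertion_count hnd' (hne l) (hne r), labs]
    rw [Set.disjoint_left]
    rintro t ⟨s, hs, -, rfl⟩ ⟨u, -, -, hu⟩
    simp only [node.injEq] at hu
    have hlen := (hperm hs).length_eq
    simp [hu.1] at hlen

lemma relabel_relabelUp (j : ℕ) (t : LTree) : relabel j (relabelUp j t) = t := by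
  induction t with
  | leaf a =>
    simp only [relabelUp, relabel, leaf.injEq]
    split_ifs <;> omega
  | node l r ihl ihr => simp [relabelUp, relabel, ihl, ihr]

lemma relabelUp_relabel {j : ℕ} {t : LTree} (h : j ∉ labs t) :
    relabelUp j (relabel j t) = t := by
  induction t with
  | leaf a =>
    simp only [labs, List.mem_singleton] at h
    simp only [relabelUp, relabel, leaf.injEq]
    split_ifs <;> omega
  | node l r ihl ihr =>
    simp only [labs, List.mem_append, not_or] at h
    simp [relabelUp, relabel, ihl h.1, ihr h.2]

lemma labs_relabelUp (j : ℕ) (t : LTree) :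
    labs (relabelUp j t) = (labs t).map (fun a => if a < j then a else a + 1) := by
  induction t with
  | leaf a => rfl
  | node l r ihl ihr => simp [relabelUp, labs, ihl, ihr]

/-- Freeing the label `i + 1` and adding it back gives the labels `1, …, m + 2`. -/
lemma IsLab.cons_labs_relabelUp {m i : ℕ} {t : LTree} (h : IsLab m t) (hi : i ≤ m + 1) :
    ((i + 1) :: labs (relabelUp (i + 1) t)).Perm ((List.range (m + 2)).map (· + 1)) := by
  rw [labs_relabelUp]
  refine ((h.2.map _).cons _).trans ?_
  rw [List.perm_ext_iff_of_nodup]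
  · intro x
    simp only [List.map_map, List.mem_cons, List.mem_map, List.mem_range, Function.comp_apply]
    constructor
    · rintro (rfl | ⟨y, hy, rfl⟩)
      · exact ⟨i, by omega, rfl⟩
      · split_ifs
        · exact ⟨y, by omega, rfl⟩
        · exact ⟨y + 1, by omega, rfl⟩
    · rintro ⟨y, hy, rfl⟩
      rcases lt_trichotomy y i with hyi | rfl | hyi
      · exact Or.inr ⟨y, by omega, by simp [hyi]⟩
      · exact Or.inl rfl
      · exact Or.inr ⟨y - 1, by omega, by split_ifs <;> omega⟩
  · rw [List.nodup_cons, List.map_map]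
    constructor
    · simp only [List.mem_map, List.mem_range, Function.comp_apply, not_exists, not_and]
      intro y _
      split_ifs <;> omega
    · refine List.nodup_range.map fun a b hab => ?_
      simp only [Function.comp_apply] at hab
      split_ifs at hab <;> omega
  · exact List.nodup_range.map fun a b hab => by simpa using hab

lemma IsLab.rank_relabelUp {m i : ℕ} {t : LTree} (h : IsLab m t) (hi : i ≤ m + 1) :
    rank (labs (relabelUp (i + 1) t)) (i + 1) = i := by
  have hrank : ∀ N, i ≤ N →
      (List.range N).countP (fun y => decide (y < i)) = i := by
    intro N hN
    obtain ⟨k, rfl⟩ := Nat.exists_eq_add_of_le hN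
    rw [List.range_add, List.countP_append, List.countP_eq_length.mpr (by simp),
      List.countP_eq_zero.mpr (by simp)]
    simp
  have hp := congrFun (rank_perm (h.cons_labs_relabelUp hi)) (i + 1)
  have h2 := hrank (m + 2) (by omega)
  simp only [rank, List.countP_cons, List.countP_map, Function.comp_def, add_lt_add_iff_right,
    lt_irrefl, decide_false, Bool.false_eq_true, if_false, add_zero] at hp
  rw [h2] at hp
  exact hp

/-- The fiber of the erasure map, split according to the erased label. -/
lemma isLab_and_botErase_eq_iff {m : ℕ} {t t' : LTree} (h : IsLab m t') :
    IsLab (m + 1) t ∧ botErase t = t' ↔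
      ∃ i < m + 2, botCut t = (relabelUp (i + 1) t', i + 1) := by
  constructor
  · rintro ⟨⟨hsize, hlabs⟩, rfl⟩
    have hnd : (labs t).Nodup := hlabs.nodup_iff.mpr
      (List.nodup_range.map fun a b hab => by simpa using hab)
    have hpos := botCut_snd_pos (by omega) hnd fun x hx => by
      obtain ⟨y, -, rfl⟩ := List.mem_map.mp (hlabs.mem_iff.mp hx)
      omega
    have hperm := labs_perm_botCut hpos
    have hj := hlabs.mem_iff.mp (hperm.mem_iff.mpr List.mem_cons_self)
    obtain ⟨i, hi, hij⟩ := List.mem_map.mp hj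
    refine ⟨i, List.mem_range.mp hi, Prod.ext ?_ hij.symm⟩
    rw [hij, botErase, relabelUp_relabel (List.nodup_cons.mp (hperm.nodup_iff.mp hnd)).1]
  · rintro ⟨i, hi, hc⟩
    have hperm := labs_perm_botCut (t := t) (by simp [hc])
    rw [hc] at hperm
    have hlabs := hperm.trans (h.cons_labs_relabelUp (by omega))
    refine ⟨⟨?_, hlabs⟩, by simp [botErase, hc, relabel_relabelUp]⟩
    have := hlabs.length_eq
    simp [length_labs] at this
    omega

lemma encard_exists_botCut_eq {m N : ℕ} {t' : LTree} (h : IsLab m t') (hN : N ≤ m + 2) :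
    {t | ∃ i < N, botCut t = (relabelUp (i + 1) t', i + 1)}.encard =
      ((∑ i ∈ Finset.range N, 2 * min i 2 : ℕ) : ℕ∞) := by
  induction N with
  | zero => simp
  | succ N ih =>
    have hsplit : {t | ∃ i < N + 1, botCut t = (relabelUp (i + 1) t', i + 1)} =
        {t | ∃ i < N, botCut t = (relabelUp (i + 1) t', i + 1)} ∪
          {t | botCut t = (relabelUp (N + 1) t', N + 1)} := by
      ext t
      simp only [Set.mem_union, Set.mem_ofPred_eq, Nat.lt_succ_iff_lt_or_eq, or_and_right,
        exists_or, exists_eq_left]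
    have hnd : ((N + 1) :: labs (relabelUp (N + 1) t')).Nodup :=
      (h.cons_labs_relabelUp (by omega)).nodup_iff.mpr
        (List.nodup_range.map fun a b hab => by simpa using hab)
    rw [hsplit, Set.encard_union_eq, ih (by omega), encard_botCut_eq N.succ_pos hnd,
      h.rank_relabelUp (by omega), Finset.sum_range_succ, Nat.cast_add]
    rw [Set.disjoint_left]
    rintro t ⟨i, hi, ht⟩ hN'
    have := congrArg Prod.snd (ht.symm.trans hN')
    simp at this
    omega

end LTree

/-- For every `n ≥ 2`, the best-of-three erasure map from labeled
binary trees of size `n` to labeled binary trees of size `n − 1` is exactly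
`(4n − 2)`-to-1: every labeled binary tree of size `n − 1` has exactly `4n − 2`
preimages. -/
theorem botErase_fibers_card (n : ℕ) (hn : 2 ≤ n) (t' : LTree)
    (h : LTree.IsLab (n - 1) t') :
    {t : LTree | LTree.IsLab n t ∧ LTree.botErase t = t'}.ncard = 4 * n - 2 := by
  obtain ⟨m, rfl⟩ : ∃ m, n = m + 1 := ⟨n - 1, by omega⟩
  rw [Nat.add_sub_cancel] at h
  have hsum : ∀ k, ∑ i ∈ Finset.range (k + 2), 2 * min i 2 = 4 * (k + 1) - 2 := by
    intro k
    induction k with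
    | zero => rfl
    | succ k ih => rw [Finset.sum_range_succ, ih]; omega
  simp only [LTree.isLab_and_botErase_eq_iff h]
  rw [Set.ncard, LTree.encard_exists_botCut_eq h le_rfl, hsum, ENat.toNat_natCast]
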